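/- Let S = K∖L be a finite relative simplicial complex carrying an h-tiling (respectively, a shellable h-tiling), and let θ be either a facet of K or a ridge of K which is a face of S. Then the stellar subdivision of S at θ carries an h-tiling (respectively, a shellable h-tiling) which uses, for each index k, the same number of critical tiles of index k as the original tiling. -/

import Mathlib

open Finset

variable {V : Type*} [DecidableEq V]

/-- A finite simplicial complex: a finite collection of finite sets of vertices
closed under taking subsets. -/
def IsComplex (K : Finset (Finset V)) : Prop :=
  ∀ σ ∈ K, ∀ τ ⊆ σ, τ ∈ K

/-- The set of nonempty faces of the relative simplicial complex `K ∖ L`. -/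
def relFaces (K L : Finset (Finset V)) : Finset (Finset V) :=
  (K \ L).filter (fun τ => τ ≠ ∅)

/-- A set `A` of faces is closed in `S`: every nonempty face of `S` contained in a
member of `A` belongs to `A`. -/
def closedIn (S A : Finset (Finset V)) : Prop :=
  ∀ τ ∈ S, τ ≠ ∅ → ∀ α ∈ A, τ ⊆ α → τ ∈ A

/-- A facet: a maximal face. -/
def IsFacetOf (K : Finset (Finset V)) (θ : Finset V) : Prop :=
  θ ∈ K ∧ ∀ σ ∈ K, θ ⊆ σ → σ = θ

instance (K : Finset (Finset V)) (θ : Finset V) : Decidable (IsFacetOf K θ) :=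
  inferInstanceAs (Decidable (θ ∈ K ∧ ∀ σ ∈ K, θ ⊆ σ → σ = θ))

/-- A ridge: a face of codimension one in every facet containing it. -/
def IsRidgeOf (K : Finset (Finset V)) (θ : Finset V) : Prop :=
  θ ∈ K ∧ ∀ σ, IsFacetOf K σ → θ ⊆ σ → σ.card = θ.card + 1

/-- Stellar subdivision of `K` at the face `θ`, using the new vertex `v`. -/
def stellar (K : Finset (Finset V)) (θ : Finset V) (v : V) : Finset (Finset V) :=
  K.filter (fun σ => ¬ θ ⊆ σ) ∪
    (K.filter (fun ρ => ¬ θ ⊆ ρ ∧ ρ ∪ θ ∈ K)).image (fun ρ => insert v ρ)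

/-- Barycentric subdivision: faces are the chains of nonempty faces of `K`. -/
def barySd (K : Finset (Finset V)) : Finset (Finset (Finset V)) :=
  K.powerset.filter (fun c => ∅ ∉ c ∧ ∀ τ ∈ c, ∀ τ' ∈ c, τ ⊆ τ' ∨ τ' ⊆ τ)

/-- A Morse tile: a simplex `simplex` deprived of the ridges not containing `res`,
together possibly with a Morse face `morse` of higher codimension. -/
structure MorseTile (V : Type*) where
  simplex : Finset V
  res : Finset V
  morse : Option (Finset V)
  simplex_nonempty : simplex.Nonempty
  res_sub : res ⊆ simplex
  morse_res : ∀ μ ∈ morse, res ⊆ μ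
  morse_ssub : ∀ μ ∈ morse, μ ⊂ simplex
  morse_card : ∀ μ ∈ morse, μ.card + 2 ≤ simplex.card

namespace MorseTile

/-- The face set of a Morse tile. -/
def faceSet (T : MorseTile V) : Finset (Finset V) :=
  match T.morse with
  | none => T.simplex.powerset.filter (fun τ => T.res ⊆ τ ∧ τ ≠ ∅)
  | some μ => T.simplex.powerset.filter (fun τ => T.res ⊆ τ ∧ ¬ τ ⊆ μ)

/-- The dimension of a Morse tile. -/
def dim (T : MorseTile V) : ℕ := T.simplex.card - 1

/-- The order of a Morse tile. -/
def order (T : MorseTile V) : ℕ := T.res.card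

/-- The index of a (critical) Morse tile. -/
def index (T : MorseTile V) : ℕ :=
  if T.res = T.simplex then T.simplex.card - 1 else T.res.card

/-- Basic tiles: no Morse face. -/
def IsBasic (T : MorseTile V) : Prop := T.morse = none

/-- Critical tiles: the Morse face equals the restriction set, or the open simplex. -/
def IsCritical (T : MorseTile V) : Prop := T.morse = some T.res ∨ T.res = T.simplex

/-- Tiles allowed in an h-tiling: basic or critical tiles. -/
def IsHTile (T : MorseTile V) : Prop := T.morse = none ∨ T.morse = some T.res

/-- The closed simplex. -/
def IsClosedSimplex (T : MorseTile V) : Prop := T.morse = none ∧ T.res = ∅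

/-- The open simplex. -/
def IsOpenSimplex (T : MorseTile V) : Prop := T.morse = none ∧ T.res = T.simplex

instance (T : MorseTile V) : Decidable T.IsCritical :=
  inferInstanceAs (Decidable (T.morse = some T.res ∨ T.res = T.simplex))

/-- Isomorphism of Morse tiles: a bijection between the underlying simplices mapping
the face set of one onto the face set of the other. -/
def Isom (T T' : MorseTile V) : Prop :=
  ∃ e : V → V, Set.InjOn e (T.simplex : Set V) ∧ T.simplex.image e = T'.simplex ∧
    T.faceSet.image (fun τ => τ.image e) = T'.faceSet

/-- The subcomplex `L_T` of removed faces of a Morse tile. -/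
def removed (T : MorseTile V) : Finset (Finset V) :=
  T.simplex.powerset.filter (fun τ => τ ∉ T.faceSet)

/-- The stellar subdivision of a Morse tile at a face `θ` of its underlying simplex,
as a relative simplicial complex. -/
def stellarSub (T : MorseTile V) (θ : Finset V) (v : V) : Finset (Finset V) :=
  relFaces (stellar T.simplex.powerset θ v) (stellar T.removed θ v)

end MorseTile

/-- The union of the face sets of a list of Morse tiles. -/
def faceUnion (ts : List (MorseTile V)) : Finset (Finset V) :=
  ts.foldr (fun T A => T.faceSet ∪ A) ∅

/-- A Morse tiling of the set `S` of nonempty faces of a relative complex: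
the face sets of the tiles partition `S`, and for every `d` the union of the
face sets of the tiles of dimension at least `d` is closed in `S`. -/
def IsMorseTiling (S : Finset (Finset V)) (ts : List (MorseTile V)) : Prop :=
  ts.Pairwise (fun T T' => Disjoint T.faceSet T'.faceSet) ∧
  faceUnion ts = S ∧
  ∀ d : ℕ, closedIn S (faceUnion (ts.filter (fun T => decide (d ≤ T.dim))))

/-- A Morse shelling: a Morse tiling whose order makes every initial union closed. -/
def IsMorseShelling (S : Finset (Finset V)) (ts : List (MorseTile V)) : Prop :=
  IsMorseTiling S ts ∧ ∀ p : ℕ, closedIn S (faceUnion (ts.take p))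

/-- An h-tiling: a Morse tiling all of whose tiles are basic or critical. -/
def IsHTiling (S : Finset (Finset V)) (ts : List (MorseTile V)) : Prop :=
  IsMorseTiling S ts ∧ ∀ T ∈ ts, T.IsHTile

/-- A shellable (shelled) h-tiling. -/
def IsHShelling (S : Finset (Finset V)) (ts : List (MorseTile V)) : Prop :=
  IsMorseShelling S ts ∧ ∀ T ∈ ts, T.IsHTile

/-- The number of critical tiles of index `k`. -/
def criticalCount (ts : List (MorseTile V)) (k : ℕ) : ℕ :=
  ts.countP (fun T => decide (T.IsCritical ∧ T.index = k))

/-- The total number of critical tiles. -/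
def totalCritical (ts : List (MorseTile V)) : ℕ :=
  ts.countP (fun T => decide T.IsCritical)

/-- The number of tiles of order `k`. -/
def hCount (ts : List (MorseTile V)) (k : ℕ) : ℕ :=
  ts.countP (fun T => decide (T.order = k))

/-- The number of `k`-dimensional faces. -/
def fCount (S : Finset (Finset V)) (k : ℕ) : ℕ :=
  (S.filter (fun τ => τ.card = k + 1)).card

/-- The Euler characteristic of a set of nonempty faces. -/
def eulerChar (S : Finset (Finset V)) : ℤ :=
  ∑ τ ∈ S, (-1 : ℤ) ^ (τ.card - 1)

/-- A pure `n`-dimensional complex: it has an `n`-dimensional face and all its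
facets have dimension `n`. -/
def IsPureDim (n : ℕ) (K : Finset (Finset V)) : Prop :=
  (∃ σ ∈ K, σ.card = n + 1) ∧ ∀ θ, IsFacetOf K θ → θ.card = n + 1

/-- A closed `n`-dimensional pseudo-manifold: a pure `n`-dimensional complex in
which every `(n-1)`-dimensional face is contained in exactly two facets. -/
def IsPseudoManifold (n : ℕ) (K : Finset (Finset V)) : Prop :=
  IsComplex K ∧ IsPureDim n K ∧
  ∀ ρ ∈ K, ρ.card = n → (K.filter (fun σ => IsFacetOf K σ ∧ ρ ⊆ σ)).card = 2

/-- Strong connectedness: any two facets are joined by a sequence of facets in which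
consecutive ones share an `(n-1)`-dimensional face. -/
def StronglyConnected (n : ℕ) (K : Finset (Finset V)) : Prop :=
  ∀ σ σ', IsFacetOf K σ → IsFacetOf K σ' →
    ∃ (m : ℕ) (c : ℕ → Finset V), c 0 = σ ∧ c m = σ' ∧
      (∀ i ≤ m, IsFacetOf K (c i)) ∧
      ∀ i < m, ∃ ρ : Finset V, ρ.card = n ∧ ρ ⊆ c i ∧ ρ ⊆ c (i + 1)

/-- Classical shellability of a finite simplicial complex. -/
def ClassicallyShellable (K : Finset (Finset V)) : Prop :=
  ∃ (N : ℕ) (f : Fin N → Finset V), Function.Injective f ∧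
    (∀ σ, IsFacetOf K σ ↔ ∃ i, f i = σ) ∧
    ∀ p : Fin N, 0 < (p : ℕ) →
      ∃ R : Finset V, R ≠ ∅ ∧ R ⊆ f p ∧
        ∀ τ : Finset V,
          ((τ ≠ ∅ ∧ τ ⊆ f p ∧ ∀ q, q < p → ¬ τ ⊆ f q) ↔ (R ⊆ τ ∧ τ ⊆ f p))

namespace MorseTile

theorem IsHTile.mem_faceSet {T : MorseTile V} (hT : T.IsHTile) {τ : Finset V} :
    τ ∈ T.faceSet ↔ τ ⊆ T.simplex ∧ T.res ⊆ τ ∧ τ ≠ ∅ ∧ T.morse ≠ some τ := by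
  rcases hT with h | h
  · simp [faceSet, h]
  · simp only [faceSet, h, mem_filter, mem_powerset, ne_eq, Option.some.injEq]
    constructor
    · rintro ⟨h1, h2, h3⟩
      exact ⟨h1, h2, fun e => h3 (e ▸ empty_subset _), fun e => h3 e.ge⟩
    · rintro ⟨h1, h2, -, h4⟩
      exact ⟨h1, h2, fun h5 => h4 (h2.antisymm h5)⟩

theorem IsHTile.simplex_mem_faceSet {T : MorseTile V} (hT : T.IsHTile) :
    T.simplex ∈ T.faceSet :=
  hT.mem_faceSet.2 ⟨subset_rfl, T.res_sub, T.simplex_nonempty.ne_empty,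
    fun h => (T.morse_ssub _ h).ne rfl⟩

end MorseTile

theorem mem_faceUnion {ts : List (MorseTile V)} {τ : Finset V} :
    τ ∈ faceUnion ts ↔ ∃ T ∈ ts, τ ∈ T.faceSet := by
  induction ts with
  | nil => simp [faceUnion]
  | cons T ts ih =>
    have : faceUnion (T :: ts) = T.faceSet ∪ faceUnion ts := rfl
    simp [this, ih]

/-- The smallest face of the original complex whose subdivision contains `τ`. -/
def carrier (θ : Finset V) (v : V) (τ : Finset V) : Finset V :=
  if v ∈ τ then τ.erase v ∪ θ else τ

theorem carrier_mono {θ : Finset V} {v : V} {τ τ' : Finset V} (h : τ ⊆ τ') :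
    carrier θ v τ ⊆ carrier θ v τ' := by
  unfold carrier
  grind

theorem mem_relFaces_stellar {K L : Finset (Finset V)} (hK : IsComplex K) (hL : IsComplex L)
    (hLK : L ⊆ K) {θ : Finset V} (hθK : θ ∈ K) (hθL : θ ∉ L) (hθne : θ ≠ ∅) {v : V}
    (hv : ∀ σ ∈ K, v ∉ σ) {τ : Finset V} :
    τ ∈ relFaces (stellar K θ v) L ↔ ¬ θ ⊆ τ ∧ carrier θ v τ ∈ relFaces K L := by
  have hvθ := hv θ hθK
  simp only [relFaces, stellar, carrier, mem_filter, mem_sdiff, mem_union, mem_image]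
  by_cases hvτ : v ∈ τ
  · have h1 : τ ∉ K := fun h => hv τ h hvτ
    have h2 : τ ∉ L := fun h => h1 (hLK h)
    simp only [hvτ, if_true, h1, h2, false_and, false_or, not_false_eq_true, and_true]
    constructor
    · rintro ⟨⟨ρ, ⟨hρ, hθρ, hρθ⟩, rfl⟩, hne⟩
      have hvρ := hv ρ hρ
      refine ⟨?_, ⟨?_, ?_⟩, ?_⟩
      · rwa [subset_insert_iff_of_notMem hvθ]
      · rwa [erase_insert hvρ]
      · exact fun h => hθL (hL _ h _ subset_union_right)
      · exact fun h => hθne (subset_empty.1 (h ▸ subset_union_right))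
    · rintro ⟨hθτ, ⟨hk, -⟩, -⟩
      refine ⟨⟨τ.erase v, ⟨hK _ hk _ subset_union_left,
        fun h => hθτ (h.trans (erase_subset _ _)), hk⟩, insert_erase hvτ⟩, ?_⟩
      rintro rfl
      simp at hvτ
  · simp only [hvτ, if_false]
    grind

/-- A subdivision of the tile `T` at `θ` with new vertex `v`: a list of h-tiles with the
dimension of `T`, shelling the faces carried by `T`, with the critical tiles of `T`. -/
structure IsTileSubdivision (θ : Finset V) (v : V) (T : MorseTile V)
    (us : List (MorseTile V)) : Prop where
  mem_faceUnion : ∀ τ, τ ∈ faceUnion us ↔ ¬ θ ⊆ τ ∧ carrier θ v τ ∈ T.faceSet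
  disjoint : us.Pairwise (fun U U' => Disjoint U.faceSet U'.faceSet)
  dim_eq : ∀ U ∈ us, U.dim = T.dim
  isHTile : ∀ U ∈ us, U.IsHTile
  count : ∀ k, criticalCount us k = criticalCount [T] k
  closed : ∀ p, closedIn (faceUnion us) (faceUnion (us.take p))

theorem isTileSubdivision_singleton {θ : Finset V} {v : V} {T : MorseTile V}
    (hT : T.IsHTile) (hv : v ∉ T.simplex) (hθ : ¬ θ ⊆ T.simplex) :
    IsTileSubdivision θ v T [T] where
  mem_faceUnion τ := by
    simp only [mem_faceUnion, List.mem_singleton, exists_eq_left]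
    by_cases hvτ : v ∈ τ
    · simp only [carrier, hvτ, if_true, hT.mem_faceSet]
      grind
    · simp only [carrier, hvτ, if_false, hT.mem_faceSet]
      grind
  disjoint := List.pairwise_singleton _ _
  dim_eq := by simp
  isHTile := by simpa using hT
  count _ := rfl
  closed p := by
    cases p with
    | zero => simp [closedIn, faceUnion]
    | succ p => simp only [closedIn, List.take_succ_cons, List.take_nil]; tauto

theorem mem_take_of_idxOf_le {α : Type*} [DecidableEq α] {l : List α} {x y : α} {p : ℕ}
    (hl : l.Nodup) (hx : x ∈ l.take p) (hy : y ∈ l) (h : l.idxOf y ≤ l.idxOf x) :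
    y ∈ l.take p := by
  obtain ⟨i, hi, rfl⟩ := List.mem_take_iff_getElem.1 hx
  rw [hl.idxOf_getElem] at h
  exact List.mem_take_iff_getElem.2 ⟨l.idxOf y, by have := List.idxOf_lt_length_of_mem hy; omega,
    List.getElem_idxOf _⟩

/-- A listing of the elements of `θ` in which those of `R` come first. -/
theorem exists_list_first (θ R : Finset V) : ∃ l : List V, l.Nodup ∧ (∀ x, x ∈ l ↔ x ∈ θ) ∧
    ∀ x ∈ θ, ∀ y ∈ θ, x ∈ R → y ∉ R → l.idxOf x < l.idxOf y := by
  refine ⟨(θ ∩ R).toList ++ (θ \ R).toList, ?_, ?_, ?_⟩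
  · refine List.nodup_append.2 ⟨nodup_toList _, nodup_toList _, ?_⟩
    simp only [mem_toList]
    grind
  · simp only [List.mem_append, mem_toList]
    grind
  · intro x hx y hy hxR hyR
    have h1 : x ∈ (θ ∩ R).toList := by simp [hx, hxR]
    have h2 : y ∉ (θ ∩ R).toList := by simp [hyR]
    rw [List.idxOf_append_of_mem h1, List.idxOf_append_of_notMem h2]
    have := List.idxOf_lt_length_of_mem h1
    omega

theorem exists_isTileSubdivision {θ : Finset V} (hθne : θ ≠ ∅) {v : V} {T : MorseTile V}
    (hT : T.IsHTile) (hv : v ∉ T.simplex) (hθ : θ ⊆ T.simplex)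
    (hcrit : T.morse = some T.res → ¬ θ ⊆ T.res) :
    ∃ us, IsTileSubdivision θ v T us := by
  obtain ⟨l, hnd, hmem, hfirst⟩ := exists_list_first θ T.res
  have hinj : ∀ x ∈ θ, ∀ y ∈ θ, l.idxOf x = l.idxOf y → x = y := fun x hx y _ h =>
    (List.idxOf_inj ((hmem x).2 hx)).1 h
  have hRσ := T.res_sub
  have hmorse : ∀ μ, T.morse = some μ → μ = T.res := by
    intro μ hμ
    rcases hT with h | h
    · simp [h] at hμ
    · rw [h] at hμ
      exact (Option.some.inj hμ).symm
  set f : V → ℕ := fun x => l.idxOf x with hf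
  set P : V → Finset V := fun x => θ.filter (fun y => f y < f x) with hP
  set r : V → Finset V := fun x =>
    (T.res \ θ) ∪ P x ∪ (if x ∈ T.res then {v} else ∅) with hr
  set s : V → Finset V := fun x => insert v (T.simplex.erase x) with hs
  have hcard : ∀ x ∈ θ, (s x).card = T.simplex.card := by
    intro x hx
    rw [hs, card_insert_of_notMem (fun h => hv (mem_of_mem_erase h)),
      card_erase_add_one (hθ hx)]
  have hrs : ∀ x ∈ θ, r x ⊆ s x := by
    intro x hx y hy
    grind
  have hex : ∀ x, ∃ U : MorseTile V, x ∈ θ → U.simplex = s x ∧ U.res = r x ∧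
      U.morse = if T.morse = some (r x) then some (r x) else none := by
    intro x
    by_cases hx : x ∈ θ
    · have hc : ∀ μ ∈ (if T.morse = some (r x) then some (r x) else none),
          μ = r x ∧ (r x).card + 2 ≤ (s x).card := by
        intro μ hμ
        split_ifs at hμ with h
        · refine ⟨(Option.mem_some.1 hμ).symm, ?_⟩
          rw [hcard x hx]
          exact T.morse_card _ h
        · simp at hμ
      refine ⟨⟨s x, r x, if T.morse = some (r x) then some (r x) else none,
        insert_nonempty _ _, hrs x hx, fun μ hμ => (hc μ hμ).1.ge, fun μ hμ => ?_,
        fun μ hμ => ?_⟩, fun _ => ⟨rfl, rfl, rfl⟩⟩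
      · obtain ⟨rfl, h⟩ := hc μ hμ
        exact (hrs x hx).ssubset_of_ne (fun e => by rw [e] at h; omega)
      · obtain ⟨rfl, h⟩ := hc μ hμ
        exact h
    · exact ⟨T, fun h => absurd h hx⟩
  choose g hg using hex
  have hgT : ∀ x ∈ θ, (g x).IsHTile := by
    intro x hx
    obtain ⟨-, h2, h3⟩ := hg x hx
    unfold MorseTile.IsHTile
    rw [h2, h3]
    split_ifs <;> simp
  have hface : ∀ x ∈ θ, ∀ τ, τ ∈ (g x).faceSet ↔
      carrier θ v τ ∈ T.faceSet ∧ x ∉ τ ∧ P x ⊆ τ := by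
    intro x hx τ
    obtain ⟨h1, h2, h3⟩ := hg x hx
    have hvR : v ∉ T.res := fun h => hv (hRσ h)
    have hxσ := hθ hx
    have hvθ : v ∉ θ := fun h => hv (hθ h)
    have hPR : ∀ y ∈ T.res, y ∈ θ → x ∉ T.res → y ∈ P x := by
      intro y hy hyθ hxR
      exact mem_filter.2 ⟨hyθ, hfirst y hyθ x hx hy hxR⟩
    rw [(hgT x hx).mem_faceSet, hT.mem_faceSet, h1, h2, h3]
    by_cases hvτ : v ∈ τ
    · simp only [carrier, hvτ, if_true]
      constructor
      · rintro ⟨a, b, c, d⟩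
        refine ⟨⟨?_, ?_, ?_, ?_⟩, ?_, ?_⟩
        · grind
        · grind
        · grind
        · intro h
          have := hmorse _ h
          rw [this] at h
          exact hcrit h (this ▸ subset_union_right)
        · grind
        · grind
      · rintro ⟨⟨a, b, c, d⟩, e, i⟩
        refine ⟨?_, ?_, ?_, ?_⟩
        · grind
        · grind
        · grind
        · split_ifs with h
          · have := hmorse _ h
            grind
          · simp
    · simp only [carrier, hvτ, if_false]
      constructor
      · rintro ⟨a, b, c, d⟩
        have hxR : x ∉ T.res := by grind
        have hRr : T.res ⊆ r x := by grind
        refine ⟨⟨?_, ?_, ?_, ?_⟩, ?_, ?_⟩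
        · grind
        · grind
        · grind
        · intro h
          have h4 := hmorse _ h
          have : r x = τ := b.antisymm (h4 ▸ hRr)
          rw [this, if_pos h] at d
          exact d rfl
        · grind
        · grind
      · rintro ⟨⟨a, b, c, d⟩, e, i⟩
        have hxR : x ∉ T.res := fun h => e (b h)
        refine ⟨?_, ?_, ?_, ?_⟩
        · grind
        · grind
        · grind
        · grind
  have hfU : ∀ τ, τ ∈ faceUnion (l.map g) ↔ ¬ θ ⊆ τ ∧ carrier θ v τ ∈ T.faceSet := by
    intro τ
    simp only [mem_faceUnion, List.mem_map, exists_exists_and_eq_and, hmem]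
    constructor
    · rintro ⟨x, hx, hτ⟩
      have := (hface x hx τ).1 hτ
      exact ⟨fun h => this.2.1 (h hx), this.1⟩
    · rintro ⟨h1, h2⟩
      obtain ⟨x, hx, hmin⟩ := exists_min_image (θ \ τ) f (sdiff_nonempty.2 h1)
      rw [mem_sdiff] at hx
      refine ⟨x, hx.1, (hface x hx.1 τ).2 ⟨h2, hx.2, fun y hy => ?_⟩⟩
      rw [mem_filter] at hy
      by_contra hyτ
      have := hmin y (mem_sdiff.2 ⟨hy.1, hyτ⟩)
      omega
  have hvθ : v ∉ θ := fun h => hv (hθ h)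
  have hmr : ∀ x y, y ∈ r x ↔
      (y ∈ T.res ∧ y ∉ θ) ∨ (y ∈ θ ∧ f y < f x) ∨ (x ∈ T.res ∧ y = v) := by
    intro x y
    simp only [hr, hP, mem_union, mem_sdiff, mem_filter, or_assoc]
    split_ifs with h <;> simp [h]
  have hms : ∀ x y, y ∈ s x ↔ y = v ∨ (y ≠ x ∧ y ∈ T.simplex) := by
    simp [hs]
  have hcritg : ∀ x ∈ θ, (g x).IsCritical ↔
      (T.morse = some T.res ∧ r x = T.res) ∨ (T.res = T.simplex ∧ P x = θ.erase x) := by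
    intro x hx
    obtain ⟨h1, h2, h3⟩ := hg x hx
    unfold MorseTile.IsCritical
    rw [h1, h2, h3]
    refine or_congr ?_ ?_
    · constructor
      · intro h
        split_ifs at h with h4
        have := hmorse _ h4
        exact ⟨this ▸ h4, this⟩
      · rintro ⟨h4, h5⟩
        rw [h5, if_pos h4]
    · have hxσ := hθ hx
      have hext : r x = s x ↔ ∀ y, y ∈ r x ↔ y ∈ s x := Finset.ext_iff
      have hextP : P x = θ.erase x ↔ ∀ y, y ∈ P x ↔ y ∈ θ.erase x := Finset.ext_iff
      simp only [hmr, hms] at hext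
      simp only [hP, mem_filter, mem_erase] at hextP
      rw [hext, hextP]
      constructor
      · intro h
        have hxR : x ∈ T.res := by
          rcases (h v).2 (Or.inl rfl) with h | h | h
          · exact absurd (hRσ h.1) hv
          · exact absurd h.1 hvθ
          · exact h.1
        have hlt : ∀ y ∈ θ, y ≠ x → f y < f x := by
          intro y hy hyx
          rcases (h y).2 (Or.inr ⟨hyx, hθ hy⟩) with h | h | h
          · exact absurd hy h.2
          · exact h.2
          · exact absurd (h.2 ▸ hy) hvθ
        refine ⟨hRσ.antisymm fun y hy => ?_, fun y => ?_⟩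
        · by_contra hyR
          have hyx : y ≠ x := fun e => hyR (e ▸ hxR)
          rcases (h y).2 (Or.inr ⟨hyx, hy⟩) with h | h | h
          · exact hyR h.1
          · have h5 : f x < f y := hfirst x hx y h.1 hxR hyR
            omega
          · exact hv (h.2 ▸ hy)
        · constructor
          · rintro ⟨a, b⟩
            exact ⟨fun e => by subst e; omega, a⟩
          · rintro ⟨a, b⟩
            exact ⟨b, hlt y b a⟩
      · rintro ⟨h4, h5⟩ y
        rw [h5 y, h4]
        by_cases hyv : y = v
        · simp [hyv, hxσ]
        · by_cases hyθ : y ∈ θ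
          · simp [hyv, hyθ, hθ hyθ]
          · have hyx : y ≠ x := fun e => hyθ (e ▸ hx)
            simp [hyv, hyθ, hyx]
  have hindex : ∀ x ∈ θ, (g x).IsCritical → (g x).index = T.index := by
    intro x hx h
    obtain ⟨h1, h2, h3⟩ := hg x hx
    have hne : T.morse = some T.res → T.res ≠ T.simplex := fun h => (T.morse_ssub _ h).ne
    have hne' : (g x).morse = some (g x).res → (g x).res ≠ (g x).simplex :=
      fun h => ((g x).morse_ssub _ h).ne
    unfold MorseTile.index
    rcases (hcritg x hx).1 h with ⟨h4, h5⟩ | ⟨h4, h5⟩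
    · rw [if_neg (hne h4), if_neg (hne' (by rw [h3, h2, h5, if_pos h4])), h2, h5]
    · have : (g x).res = (g x).simplex := by
        rcases h with h | h
        · rw [h2, h3] at h
          split_ifs at h with h6
          exact absurd h4 (hne (hmorse _ h6 ▸ h6))
        · exact h
      rw [if_pos h4, if_pos this, h1, hcard x hx]
  have huniq : ∀ x ∈ θ, ∀ y ∈ θ, (g x).IsCritical → (g y).IsCritical → x = y := by
    have key : ∀ x ∈ θ, ∀ y ∈ θ, (g x).IsCritical → (g y).IsCritical → ¬ f x < f y := by
      intro x hx y hy hcx hcy hlt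
      have hxP : x ∈ P y := mem_filter.2 ⟨hx, hlt⟩
      have hyP : y ∉ P x := fun h => by have := (mem_filter.1 h).2; omega
      have hne : T.morse = some T.res → T.res ≠ T.simplex := fun h => (T.morse_ssub _ h).ne
      rcases (hcritg x hx).1 hcx with ⟨h4, h5⟩ | ⟨h4, h5⟩ <;>
        rcases (hcritg y hy).1 hcy with ⟨h6, h7⟩ | ⟨h6, h7⟩
      · have hxR : x ∈ T.res := by
          rw [← h7, hmr]
          exact Or.inr (Or.inl ⟨hx, hlt⟩)
        have : v ∈ r x := (hmr x v).2 (Or.inr (Or.inr ⟨hxR, rfl⟩))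
        exact hv (hRσ (h5 ▸ this))
      · exact hne h4 h6
      · exact hne h6 h4
      · have hyx : y ∈ θ.erase x := mem_erase.2 ⟨fun e => by subst e; omega, hy⟩
        exact hyP (h5 ▸ hyx)
    intro x hx y hy hcx hcy
    refine hinj x hx y hy ?_
    have h1 := key x hx y hy hcx hcy
    have h2 := key y hy x hx hcy hcx
    change f x = f y
    omega
  have hexists : T.IsCritical → ∃ x ∈ θ, (g x).IsCritical := by
    rintro (h | h)
    · obtain ⟨x, hx, hmin⟩ := exists_min_image (θ \ T.res) f (sdiff_nonempty.2 (hcrit h))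
      rw [mem_sdiff] at hx
      refine ⟨x, hx.1, (hcritg x hx.1).2 (Or.inl ⟨h, ?_⟩)⟩
      ext y
      have h1 : y ∈ θ → y ∉ T.res → f x ≤ f y := fun a b => hmin y (mem_sdiff.2 ⟨a, b⟩)
      have h2 : y ∈ θ → y ∈ T.res → f y < f x := fun a b => hfirst y a x hx.1 b hx.2
      simp only [hr, hP, if_neg hx.2, mem_union, mem_sdiff, mem_filter, notMem_empty, or_false]
      by_cases hyR : y ∈ T.res
      · by_cases hyθ : y ∈ θ <;> simp [hyR, hyθ, h2]
      · by_cases hyθ : y ∈ θ <;> simp [hyR, hyθ, h1]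
    · obtain ⟨x, hx, hmax⟩ := exists_max_image θ f (nonempty_iff_ne_empty.2 hθne)
      refine ⟨x, hx, (hcritg x hx).2 (Or.inr ⟨h, ?_⟩)⟩
      ext y
      simp only [hP, mem_filter, mem_erase]
      constructor
      · rintro ⟨a, b⟩
        exact ⟨fun e => by subst e; omega, a⟩
      · rintro ⟨a, b⟩
        exact ⟨b, lt_of_le_of_ne (hmax y b) fun e => a (hinj y b x hx e)⟩
  have hcritT : ∀ x ∈ θ, (g x).IsCritical → T.IsCritical := by
    intro x hx h
    rcases (hcritg x hx).1 h with h | h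
    · exact Or.inl h.1
    · exact Or.inr h.1
  refine ⟨l.map g, hfU, ?_, ?_, ?_, ?_, ?_⟩
  · refine List.pairwise_map.2 (hnd.imp_of_mem ?_)
    intro x y hx hy hxy
    rw [hmem] at hx hy
    refine disjoint_left.2 fun τ h1 h2 => hxy (hinj x hx y hy ?_)
    obtain ⟨-, a, b⟩ := (hface x hx τ).1 h1
    obtain ⟨-, c, d⟩ := (hface y hy τ).1 h2
    have h3 : ¬ f x < f y := fun h => a (d (mem_filter.2 ⟨hx, h⟩))
    have h4 : ¬ f y < f x := fun h => c (b (mem_filter.2 ⟨hy, h⟩))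
    change f x = f y
    omega
  · simp only [List.mem_map, hmem, forall_exists_index, and_imp, forall_apply_eq_imp_iff₂]
    intro x hx
    rw [MorseTile.dim, MorseTile.dim, (hg x hx).1, hcard x hx]
  · simpa only [List.mem_map, hmem, forall_exists_index, and_imp, forall_apply_eq_imp_iff₂]
      using hgT
  · intro k
    simp only [criticalCount, List.countP_map, List.countP_singleton, decide_eq_true_eq]
    by_cases h : T.IsCritical ∧ T.index = k
    · rw [if_pos h]
      obtain ⟨x, hx, hxc⟩ := hexists h.1
      rw [← List.count_eq_one_of_mem hnd ((hmem x).2 hx), List.count]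
      refine List.countP_congr fun y hy => ?_
      rw [hmem] at hy
      simp only [Function.comp, decide_eq_true_eq, beq_iff_eq]
      constructor
      · exact fun hyc => huniq y hy x hx hyc.1 hxc
      · rintro rfl
        exact ⟨hxc, (hindex _ hx hxc).trans h.2⟩
    · rw [if_neg h, List.countP_eq_zero]
      intro x hx hxc
      rw [hmem] at hx
      simp only [Function.comp, decide_eq_true_eq] at hxc
      exact h ⟨hcritT x hx hxc.1, (hindex x hx hxc.1).symm.trans hxc.2⟩
  · intro p τ hτ _ α hα hτα
    rw [← List.map_take, mem_faceUnion] at *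
    simp only [List.mem_map, exists_exists_and_eq_and] at hα hτ ⊢
    obtain ⟨x, hx, hxα⟩ := hα
    obtain ⟨y, hy, hyτ⟩ := hτ
    refine ⟨y, mem_take_of_idxOf_le hnd hx hy ?_, hyτ⟩
    have hx' := (hmem x).1 (List.mem_of_mem_take hx)
    obtain ⟨-, a, -⟩ := (hface x hx' α).1 hxα
    obtain ⟨-, -, b⟩ := (hface y ((hmem y).1 hy) τ).1 hyτ
    by_contra! h
    exact a (hτα (b (mem_filter.2 ⟨hx', h⟩)))

theorem take_flatMap {α β : Type*} (F : α → List β) (l : List α) (p : ℕ) :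
    (l.flatMap F).take p = l.flatMap F ∨
    ∃ n q a, l.take (n + 1) = l.take n ++ [a] ∧
      (l.flatMap F).take p = (l.take n).flatMap F ++ (F a).take q := by
  induction l generalizing p with
  | nil => simp
  | cons a l ih =>
    by_cases h : p ≤ (F a).length
    · exact Or.inr ⟨0, p, a, by simp, by simp [List.take_append_of_le_length h]⟩
    · have key : ((a :: l).flatMap F).take p =
          F a ++ (l.flatMap F).take (p - (F a).length) := by
        rw [List.flatMap_cons, List.take_append, List.take_of_length_le (by omega)]
      rcases ih (p - (F a).length) with h1 | ⟨n, q, b, h1, h2⟩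
      · exact Or.inl (by rw [key, h1, List.flatMap_cons])
      · exact Or.inr ⟨n + 1, q, b, by simp [h1], by rw [key, h2]; simp⟩

section Subdivide

variable {S S' : Finset (Finset V)} {θ : Finset V} {v : V}
  {F : MorseTile V → List (MorseTile V)} {ts : List (MorseTile V)}

theorem mem_faceUnion_flatMap (hF : ∀ T ∈ ts, IsTileSubdivision θ v T (F T)) {τ : Finset V} :
    τ ∈ faceUnion (ts.flatMap F) ↔ ¬ θ ⊆ τ ∧ carrier θ v τ ∈ faceUnion ts := by
  have h : τ ∈ faceUnion (ts.flatMap F) ↔ ∃ T ∈ ts, τ ∈ faceUnion (F T) := by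
    simp only [mem_faceUnion, List.mem_flatMap]
    grind
  rw [h, mem_faceUnion]
  constructor
  · rintro ⟨T, hT, hτ⟩
    obtain ⟨a, b⟩ := ((hF T hT).mem_faceUnion τ).1 hτ
    exact ⟨a, T, hT, b⟩
  · rintro ⟨a, T, hT, b⟩
    exact ⟨T, hT, ((hF T hT).mem_faceUnion τ).2 ⟨a, b⟩⟩

theorem closedIn_carrier (hS' : ∀ τ, τ ∈ S' ↔ ¬ θ ⊆ τ ∧ carrier θ v τ ∈ S)
    (hS : ∅ ∉ S) {A A' : Finset (Finset V)} (hA : closedIn S A)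
    (hA' : ∀ τ, τ ∈ A' ↔ ¬ θ ⊆ τ ∧ carrier θ v τ ∈ A) : closedIn S' A' := by
  intro τ hτ _ α hα hτα
  obtain ⟨a, b⟩ := (hS' τ).1 hτ
  exact (hA' τ).2 ⟨a, hA _ b (fun e => hS (e ▸ b)) _ ((hA' α).1 hα).2 (carrier_mono hτα)⟩

theorem filter_flatMap_dim (hF : ∀ T ∈ ts, IsTileSubdivision θ v T (F T)) (d : ℕ) :
    (ts.flatMap F).filter (fun T => decide (d ≤ T.dim)) =
      (ts.filter (fun T => decide (d ≤ T.dim))).flatMap F := by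
  induction ts with
  | nil => rfl
  | cons T ts ih =>
    have hT := (hF T List.mem_cons_self).dim_eq
    rw [List.flatMap_cons, List.filter_append, ih fun U hU => hF U (List.mem_cons_of_mem _ hU)]
    by_cases h : d ≤ T.dim
    · rw [List.filter_cons_of_pos (by simpa using h), List.flatMap_cons,
        List.filter_eq_self.2 fun U hU => by simpa [hT U hU] using h]
    · rw [List.filter_cons_of_neg (by simpa using h),
        List.filter_eq_nil_iff.2 fun U hU => by simpa [hT U hU] using h, List.nil_append]

theorem IsHTiling.flatMap (hF : ∀ T ∈ ts, IsTileSubdivision θ v T (F T))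
    (hS' : ∀ τ, τ ∈ S' ↔ ¬ θ ⊆ τ ∧ carrier θ v τ ∈ S) (hS : ∅ ∉ S) (h : IsHTiling S ts) :
    IsHTiling S' (ts.flatMap F) := by
  obtain ⟨⟨hdisj, hunion, hdim⟩, -⟩ := h
  refine ⟨⟨?_, ?_, fun d => ?_⟩, ?_⟩
  · refine List.pairwise_flatMap.2 ⟨fun T hT => (hF T hT).disjoint, hdisj.imp_of_mem ?_⟩
    intro T T' hT hT' hTT' U hU U' hU'
    refine disjoint_left.2 fun τ hτ hτ' => disjoint_left.1 hTT'
      (((hF T hT).mem_faceUnion τ).1 (mem_faceUnion.2 ⟨U, hU, hτ⟩)).2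
      (((hF T' hT').mem_faceUnion τ).1 (mem_faceUnion.2 ⟨U', hU', hτ'⟩)).2
  · ext τ
    rw [mem_faceUnion_flatMap hF, hunion, hS']
  · rw [filter_flatMap_dim hF]
    exact closedIn_carrier hS' hS (hdim d)
      fun τ => mem_faceUnion_flatMap fun T hT => hF T (List.mem_of_mem_filter hT)
  · intro U hU
    obtain ⟨T, hT, hU⟩ := List.mem_flatMap.1 hU
    exact (hF T hT).isHTile U hU

theorem IsHShelling.flatMap (hF : ∀ T ∈ ts, IsTileSubdivision θ v T (F T))
    (hS' : ∀ τ, τ ∈ S' ↔ ¬ θ ⊆ τ ∧ carrier θ v τ ∈ S) (hS : ∅ ∉ S) (h : IsHShelling S ts) :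
    IsHShelling S' (ts.flatMap F) := by
  obtain ⟨⟨hmt, hclosed⟩, hht⟩ := h
  obtain ⟨hmt', hht'⟩ := IsHTiling.flatMap hF hS' hS ⟨hmt, hht⟩
  refine ⟨⟨hmt', fun p => ?_⟩, hht'⟩
  rcases take_flatMap F ts p with h | ⟨n, q, T, hn, h⟩
  · rw [h, hmt'.2.1]
    exact fun τ hτ _ _ _ _ => hτ
  have hFn : ∀ n, ∀ U ∈ ts.take n, IsTileSubdivision θ v U (F U) :=
    fun n U hU => hF U (List.mem_of_mem_take hU)
  have hT := hFn (n + 1) T (by simp [hn])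
  have happ : ∀ us us' : List (MorseTile V), ∀ τ,
      τ ∈ faceUnion (us ++ us') ↔ τ ∈ faceUnion us ∨ τ ∈ faceUnion us' := by
    intro us us' τ
    simp only [mem_faceUnion, List.mem_append]
    grind
  have hnext := closedIn_carrier hS' hS (hclosed (n + 1)) fun τ =>
    mem_faceUnion_flatMap (hFn (n + 1))
  have hprev := closedIn_carrier hS' hS (hclosed n) fun τ => mem_faceUnion_flatMap (hFn n)
  intro τ hτ hτne α hα hτα
  rw [h, happ] at hα ⊢
  rcases hα with hα | hα
  · exact Or.inl (hprev τ hτ hτne α hα hτα)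
  · have hα' : α ∈ faceUnion (F T) := by
      rw [mem_faceUnion] at hα ⊢
      obtain ⟨U, hU, hα⟩ := hα
      exact ⟨U, List.mem_of_mem_take hU, hα⟩
    have hτ' := hnext τ hτ hτne α
    rw [hn, List.flatMap_append, List.flatMap_singleton, happ, happ] at hτ'
    rcases hτ' (Or.inr hα') hτα with hτ' | hτ'
    · exact Or.inl hτ'
    · exact Or.inr (hT.closed q τ hτ' hτne α hα hτα)

theorem criticalCount_flatMap (hF : ∀ T ∈ ts, IsTileSubdivision θ v T (F T)) (k : ℕ) :
    criticalCount (ts.flatMap F) k = criticalCount ts k := by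
  induction ts with
  | nil => rfl
  | cons T ts ih =>
    have h1 := (hF T List.mem_cons_self).count k
    have h2 := ih fun U hU => hF U (List.mem_cons_of_mem _ hU)
    rw [List.flatMap_cons, ← List.singleton_append]
    unfold criticalCount at *
    rw [List.countP_append, List.countP_append, h1, h2]

end Subdivide

theorem card_le_of_facet_or_ridge {K : Finset (Finset V)} {θ σ : Finset V}
    (hθ : IsFacetOf K θ ∨ IsRidgeOf K θ) (hσ : σ ∈ K) (hθσ : θ ⊆ σ) :
    σ.card ≤ θ.card + 1 := by
  rcases hθ with hθ | hθ
  · rw [hθ.2 σ hσ hθσ]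
    omega
  · obtain ⟨ρ, hσρ, hρ⟩ := K.exists_le_maximal hσ
    have hfac : IsFacetOf K ρ := ⟨hρ.prop, fun α hα h => (hρ.le_of_ge hα h).antisymm h⟩
    rw [← hθ.2 ρ hfac (hθσ.trans hσρ)]
    exact card_le_card hσρ

/-- h-tilings and shellable h-tilings survive stellar subdivision at a
facet or at a ridge, with the same numbers of critical tiles of each index. -/
theorem htiling_stellar_subdivision_facet_or_ridge {V : Type*} [DecidableEq V]
    (K L : Finset (Finset V))
    (hK : IsComplex K) (hL : IsComplex L) (hLK : L ⊆ K)
    (hfac : ∀ σ, IsFacetOf K σ → σ ∉ L)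
    (θ : Finset V) (hθ : IsFacetOf K θ ∨ (IsRidgeOf K θ ∧ θ ∉ L)) (hθne : θ ≠ ∅)
    (v : V) (hv : ∀ σ ∈ K, v ∉ σ) :
    (∀ ts : List (MorseTile V), IsHTiling (relFaces K L) ts →
      ∃ ts' : List (MorseTile V), IsHTiling (relFaces (stellar K θ v) L) ts' ∧
        ∀ k, criticalCount ts' k = criticalCount ts k) ∧
    (∀ ts : List (MorseTile V), IsHShelling (relFaces K L) ts →
      ∃ ts' : List (MorseTile V), IsHShelling (relFaces (stellar K θ v) L) ts' ∧
        ∀ k, criticalCount ts' k = criticalCount ts k) := by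
  have hθK : θ ∈ K := hθ.elim (fun h => h.1) (fun h => h.1.1)
  have hθL : θ ∉ L := hθ.elim (hfac θ) (fun h => h.2)
  have hS : ∅ ∉ relFaces K L := by simp [relFaces]
  have hS' := fun τ => mem_relFaces_stellar hK hL hLK hθK hθL hθne hv (τ := τ)
  have key : ∀ ts, IsHTiling (relFaces K L) ts →
      ∃ F : MorseTile V → List (MorseTile V), ∀ T ∈ ts, IsTileSubdivision θ v T (F T) := by
    intro ts hts
    have hex : ∀ T : MorseTile V, ∃ us, T ∈ ts → IsTileSubdivision θ v T us := by
      intro T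
      by_cases hT : T ∈ ts
      · have hTh := hts.2 T hT
        have hσ : T.simplex ∈ relFaces K L :=
          hts.1.2.1 ▸ mem_faceUnion.2 ⟨T, hT, hTh.simplex_mem_faceSet⟩
        have hσK : T.simplex ∈ K := (mem_sdiff.1 (mem_filter.1 hσ).1).1
        by_cases hθT : θ ⊆ T.simplex
        · obtain ⟨us, hus⟩ := exists_isTileSubdivision hθne hTh (hv _ hσK) hθT fun h hle => by
            have h1 := T.morse_card _ h
            have h2 := card_le_card hle
            have h3 := card_le_of_facet_or_ridge (hθ.imp_right And.left) hσK hθT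
            omega
          exact ⟨us, fun _ => hus⟩
        · exact ⟨[T], fun _ => isTileSubdivision_singleton hTh (hv _ hσK) hθT⟩
      · exact ⟨[], fun h => absurd h hT⟩
    choose F hF using hex
    exact ⟨F, hF⟩
  refine ⟨fun ts hts => ?_, fun ts hts => ?_⟩
  · obtain ⟨F, hF⟩ := key ts hts
    exact ⟨ts.flatMap F, hts.flatMap hF hS' hS, criticalCount_flatMap hF⟩
  · obtain ⟨F, hF⟩ := key ts ⟨hts.1.1, hts.2⟩
    exact ⟨ts.flatMap F, hts.flatMap hF hS' hS, criticalCount_flatMap hF⟩
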